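/- arXiv:2102.08343 — 5 statements merged into one kernel-verified Lean document; each statement's English description precedes it below -/
import Mathlib

section
/- Let (Z, d) be a metric space, α ∈ ℝ, β > 0, and let f(z,z') = exp(α − β·d(z,z')) and s(z,z') = d(z,z')². Let p₀ and p₁ be probability measures on Z, and let the joint law of (z,c) ∈ Z × {0,1} be the uniform mixture with P(c=0) = P(c=1) = 1/2 and z | c=i distributed as pᵢ. Define g(z,z') = (f(z,z') − s(z,z'))/8 and w(z,z') = (f(z,z') + s(z,z'))/8. Then ICL(z,c) := E_{(z,c),(z',c') iid}[ 1(c = c')·f(z,z') + 1(c ≠ c')·s(z,z') ] satisfies ICL(z,c) = MMD_g(p₀,p₁) + R_w(p₀,p₁), assuming all the expectations involved are finite. -/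
open MeasureTheory
open scoped ENNReal

/-- Integrability against a product of two slices `{c = a}` and `{c = b}`; no measurability of `F`
is required. -/
theorem integrable_prod_map_slice_iff {Z : Type*} [MeasurableSpace Z] (p q : Measure Z)
    [SFinite p] [SFinite q] (a b : Bool) (F : (Z × Bool) × (Z × Bool) → ℝ) :
    Integrable F ((p.map (fun z => (z, a))).prod (q.map (fun z => (z, b)))) ↔
      Integrable (fun x : Z × Z => F ((x.1, a), (x.2, b))) (p.prod q) := by
  have ha : MeasurableEmbedding (fun z : Z => (z, a)) := measurableEmbedding_prod_mk_right a
  have hb : MeasurableEmbedding (fun z : Z => (z, b)) := measurableEmbedding_prod_mk_right b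
  rw [Measure.map_prod_map p q ha.measurable hb.measurable,
    (ha.prodMap hb).integrable_map_iff]
  rfl

/-- Integral against a product of two slices `{c = a}` and `{c = b}`; no measurability of `F` is
required. -/
theorem integral_prod_map_slice {Z : Type*} [MeasurableSpace Z] (p q : Measure Z)
    [SFinite p] [SFinite q] (a b : Bool) (F : (Z × Bool) × (Z × Bool) → ℝ) :
    ∫ x, F x ∂((p.map (fun z => (z, a))).prod (q.map (fun z => (z, b)))) =
      ∫ x : Z × Z, F ((x.1, a), (x.2, b)) ∂(p.prod q) := by
  have ha : MeasurableEmbedding (fun z : Z => (z, a)) := measurableEmbedding_prod_mk_right a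
  have hb : MeasurableEmbedding (fun z : Z => (z, b)) := measurableEmbedding_prod_mk_right b
  rw [Measure.map_prod_map p q ha.measurable hb.measurable,
    (ha.prodMap hb).integral_map]
  rfl

/-- Integral against the square of the balanced mixture of two slices. -/
theorem integral_prod_self_balanced_mixture {Z : Type*} [MeasurableSpace Z] (p q : Measure Z)
    [SFinite p] [SFinite q] (F : (Z × Bool) × (Z × Bool) → ℝ)
    (h00 : Integrable (fun x : Z × Z => F ((x.1, false), (x.2, false))) (p.prod p))
    (h01 : Integrable (fun x : Z × Z => F ((x.1, false), (x.2, true))) (p.prod q))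
    (h10 : Integrable (fun x : Z × Z => F ((x.1, true), (x.2, false))) (q.prod p))
    (h11 : Integrable (fun x : Z × Z => F ((x.1, true), (x.2, true))) (q.prod q)) :
    ∫ x, F x ∂(((1 / 2 : ℝ≥0∞) • p.map (fun z => (z, false))
          + (1 / 2 : ℝ≥0∞) • q.map (fun z => (z, true))).prod
        ((1 / 2 : ℝ≥0∞) • p.map (fun z => (z, false))
          + (1 / 2 : ℝ≥0∞) • q.map (fun z => (z, true)))) =
      ((∫ x : Z × Z, F ((x.1, false), (x.2, false)) ∂(p.prod p))
        + (∫ x : Z × Z, F ((x.1, false), (x.2, true)) ∂(p.prod q))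
        + (∫ x : Z × Z, F ((x.1, true), (x.2, false)) ∂(q.prod p))
        + ∫ x : Z × Z, F ((x.1, true), (x.2, true)) ∂(q.prod q)) / 4 := by
  rw [← integrable_prod_map_slice_iff] at h00 h01 h10 h11
  rw [← smul_add, Measure.prod_smul_left, Measure.prod_smul_right, integral_smul_measure,
    integral_smul_measure, Measure.prod_add, Measure.add_prod, Measure.add_prod,
    integral_add_measure (h00.add_measure h10) (h01.add_measure h11),
    integral_add_measure h00 h10, integral_add_measure h01 h11]
  simp only [integral_prod_map_slice, one_div, ENNReal.toReal_inv, ENNReal.toReal_ofNat,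
    smul_eq_mul]
  ring

/-- Binary case of Lemma 1 (ICL = MMD_g + R_w): for the joint law `μ` given by the
uniform mixture of `p₀` (with `c = false`) and `p₁` (with `c = true`), the inverse
contrastive loss equals the sum of the MMD divergence with kernel
`g = (f − s)/8` and the interaction energy functional with potential `w = (f + s)/8`. -/
theorem icl_eq_mmd_add_interaction_energy
    {Z : Type*} [MetricSpace Z] [MeasurableSpace Z] [BorelSpace Z]
    (α β : ℝ) (hβ : 0 < β)
    (f s g w : Z → Z → ℝ)
    (hf : ∀ z z' : Z, f z z' = Real.exp (α - β * dist z z'))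
    (hs : ∀ z z' : Z, s z z' = dist z z' ^ 2)
    (hg : ∀ z z' : Z, g z z' = (f z z' - s z z') / 8)
    (hw : ∀ z z' : Z, w z z' = (f z z' + s z z') / 8)
    (p₀ p₁ : Measure Z) [IsProbabilityMeasure p₀] [IsProbabilityMeasure p₁]
    (μ : Measure (Z × Bool))
    (hμ : μ = (1 / 2 : ℝ≥0∞) • Measure.map (fun z => (z, false)) p₀
            + (1 / 2 : ℝ≥0∞) • Measure.map (fun z => (z, true)) p₁)
    (hICLint : Integrable (fun q : (Z × Bool) × (Z × Bool) =>
        if q.1.2 = q.2.2 then f q.1.1 q.2.1 else s q.1.1 q.2.1) (μ.prod μ))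
    (hf00 : Integrable (fun q : Z × Z => f q.1 q.2) (p₀.prod p₀))
    (hf11 : Integrable (fun q : Z × Z => f q.1 q.2) (p₁.prod p₁))
    (hf01 : Integrable (fun q : Z × Z => f q.1 q.2) (p₀.prod p₁))
    (hs00 : Integrable (fun q : Z × Z => s q.1 q.2) (p₀.prod p₀))
    (hs11 : Integrable (fun q : Z × Z => s q.1 q.2) (p₁.prod p₁))
    (hs01 : Integrable (fun q : Z × Z => s q.1 q.2) (p₀.prod p₁)) :
    (∫ q, (if q.1.2 = q.2.2 then f q.1.1 q.2.1 else s q.1.1 q.2.1) ∂(μ.prod μ))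
      = ((∫ z, ∫ z', g z z' ∂p₀ ∂p₀) + (∫ z, ∫ z', g z z' ∂p₁ ∂p₁)
          - 2 * ∫ z, ∫ z', g z z' ∂p₁ ∂p₀)
        + ((∫ z, ∫ z', w z z' ∂p₀ ∂p₀) + (∫ z, ∫ z', w z z' ∂p₁ ∂p₁)
          + 2 * ∫ z, ∫ z', w z z' ∂p₁ ∂p₀) := by
  have s_comm : ∀ x y, s x y = s y x := fun x y => by rw [hs, hs, dist_comm]
  have hs10 : Integrable (fun q : Z × Z => s q.1 q.2) (p₁.prod p₀) :=
    hs01.swap.congr (.of_forall fun x => s_comm x.2 x.1)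
  have hs_symm : ∫ x : Z × Z, s x.1 x.2 ∂(p₁.prod p₀) = ∫ x : Z × Z, s x.1 x.2 ∂(p₀.prod p₁) := by
    rw [← integral_prod_swap]
    exact integral_congr_ae (.of_forall fun x => s_comm x.2 x.1)
  have hg_int : ∀ (p q : Measure Z) [IsProbabilityMeasure p] [IsProbabilityMeasure q],
      Integrable (fun x : Z × Z => f x.1 x.2) (p.prod q) →
      Integrable (fun x : Z × Z => s x.1 x.2) (p.prod q) →
      ∫ z, ∫ z', g z z' ∂q ∂p
        = ((∫ x : Z × Z, f x.1 x.2 ∂(p.prod q)) - ∫ x : Z × Z, s x.1 x.2 ∂(p.prod q)) / 8 := by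
    intro p q _ _ h1 h2
    simp only [hg]
    rw [← integral_sub h1 h2, ← integral_div]
    exact (integral_prod _ ((h1.sub h2).div_const 8)).symm
  have hw_int : ∀ (p q : Measure Z) [IsProbabilityMeasure p] [IsProbabilityMeasure q],
      Integrable (fun x : Z × Z => f x.1 x.2) (p.prod q) →
      Integrable (fun x : Z × Z => s x.1 x.2) (p.prod q) →
      ∫ z, ∫ z', w z z' ∂q ∂p
        = ((∫ x : Z × Z, f x.1 x.2 ∂(p.prod q)) + ∫ x : Z × Z, s x.1 x.2 ∂(p.prod q)) / 8 := by
    intro p q _ _ h1 h2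
    simp only [hw]
    rw [← integral_add h1 h2, ← integral_div]
    exact (integral_prod _ ((h1.add h2).div_const 8)).symm
  rw [hμ, integral_prod_self_balanced_mixture p₀ p₁ _ (by simpa using hf00) (by simpa using hs01)
    (by simpa using hs10) (by simpa using hf11), hg_int _ _ hf00 hs00, hg_int _ _ hf11 hs11,
    hg_int _ _ hf01 hs01, hw_int _ _ hf00 hs00, hw_int _ _ hf11 hs11, hw_int _ _ hf01 hs01]
  simp only [↓reduceIte, Bool.false_eq_true, Bool.true_eq_false, hs_symm]
  ring
end

section
/- Let (Z, d) be a metric space, let (z,c) be a Z × ℝ valued random pair with joint law μ, let α ∈ ℝ, β > 0, δ > 0, and set ρ = P_{(z,c),(z',c') iid ~ μ}(|c − c'| > δ). Let b : Z → ℝ be L-Lipschitz with respect to d (L > 0), and assume E[(b(z) − c)²] and the ICL expectation are well-defined and finite. If ε satisfies ε < δ²ρ²/L² and ICL^δ_{α,β}(z,c) < ε, then E[(b(z) − c)²] ≥ (δρ − L√ε)²/4. -/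
open MeasureTheory
open scoped ENNReal

/-- The weighted inequality of arithmetic and geometric means, linear in the square of `x`. -/
lemma le_half_add_sq_div {x t : ℝ} (ht : 0 < t) : x ≤ t / 2 + x ^ 2 / (2 * t) := by
  have h : t / 2 + x ^ 2 / (2 * t) - x = (x - t) ^ 2 / (2 * t) := by
    field_simp
    ring
  have : 0 ≤ (x - t) ^ 2 / (2 * t) := by positivity
  linarith

/-- If the inverse contrastive loss `ICL^δ_{α,β}(z,c)` is smaller than
`ε < δ²ρ²/L²`, where `ρ = P(|c − c'| > δ)`, then the mean squared error of any
`L`-Lipschitz adversary `b` predicting `c` from `z` is at least `(δρ − L√ε)²/4`. -/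
theorem icl_small_implies_mse_lower_bound
    {Z : Type*} [MetricSpace Z] [MeasurableSpace Z] [BorelSpace Z]
    (α β δ : ℝ) (hβ : 0 < β) (hδ : 0 < δ)
    (μ : Measure (Z × ℝ)) [IsProbabilityMeasure μ]
    (b : Z → ℝ) (L : ℝ) (hL : 0 < L)
    (hb : ∀ z z' : Z, |b z - b z'| ≤ L * dist z z')
    (ρ : ℝ) (hρ : ρ = ((μ.prod μ) {q : (Z × ℝ) × (Z × ℝ) | δ < |q.1.2 - q.2.2|}).toReal)
    (hmse : Integrable (fun p : Z × ℝ => (b p.1 - p.2) ^ 2) μ)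
    (hicl : Integrable (fun q : (Z × ℝ) × (Z × ℝ) =>
        if |q.1.2 - q.2.2| ≤ δ then Real.exp (α - β * dist q.1.1 q.2.1)
        else dist q.1.1 q.2.1 ^ 2) (μ.prod μ))
    (ε : ℝ) (hε : ε < δ ^ 2 * ρ ^ 2 / L ^ 2)
    (hIC : (∫ q, (if |q.1.2 - q.2.2| ≤ δ then Real.exp (α - β * dist q.1.1 q.2.1)
        else dist q.1.1 q.2.1 ^ 2) ∂(μ.prod μ)) < ε) :
    (δ * ρ - L * Real.sqrt ε) ^ 2 / 4 ≤ ∫ p, (b p.1 - p.2) ^ 2 ∂μ := by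
  set f : (Z × ℝ) × (Z × ℝ) → ℝ := fun q =>
    if |q.1.2 - q.2.2| ≤ δ then Real.exp (α - β * dist q.1.1 q.2.1)
    else dist q.1.1 q.2.1 ^ 2 with hf
  set r : Z × ℝ → ℝ := fun p => (b p.1 - p.2) ^ 2 with hr
  set D : Set ((Z × ℝ) × (Z × ℝ)) := {q | δ < |q.1.2 - q.2.2|}
  have hf0 : ∀ q, 0 ≤ f q := fun q => by
    simp only [hf]
    split_ifs <;> positivity
  have hr0 : ∀ p, 0 ≤ r p := fun p => sq_nonneg _
  have hε0 : 0 < ε := (integral_nonneg hf0).trans_lt hIC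
  have hs : 0 < √ε := Real.sqrt_pos.2 hε0
  have hρ0 : 0 ≤ ρ := hρ ▸ ENNReal.toReal_nonneg
  have hDm : MeasurableSet D :=
    measurableSet_lt measurable_const
      ((measurable_fst.snd.sub measurable_snd.snd).abs)
  have hgap : 0 < δ * ρ - L * √ε := by
    have hsq : (L * √ε) ^ 2 < (δ * ρ) ^ 2 := by
      rw [lt_div_iff₀ (by positivity)] at hε
      rw [mul_pow, mul_pow, Real.sq_sqrt hε0.le]
      linarith
    exact sub_pos.2 (lt_of_pow_lt_pow_left₀ 2 (by positivity) hsq)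
  obtain ⟨t, ht_def⟩ : ∃ t, t = (δ * ρ - L * √ε) / 2 := ⟨_, rfl⟩
  have ht : 0 < t := ht_def ▸ half_pos hgap
  have hpt : ∀ q, D.indicator (fun _ => δ) q ≤
      t + (r q.1 + r q.2) / (2 * t) + L * (√ε / 2 + f q / (2 * √ε)) := by
    intro q
    by_cases hq : q ∈ D
    · have hfq : f q = dist q.1.1 q.2.1 ^ 2 := if_neg (not_le.2 hq)
      have h1 := le_half_add_sq_div (x := |b q.1.1 - q.1.2|) ht
      have h2 := le_half_add_sq_div (x := |b q.2.1 - q.2.2|) ht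
      have h3 := mul_le_mul_of_nonneg_left
        (le_half_add_sq_div (x := dist q.1.1 q.2.1) hs) hL.le
      have h4 : |q.1.2 - q.2.2| ≤
          |b q.1.1 - q.1.2| + |b q.2.1 - q.2.2| + |b q.1.1 - b q.2.1| := by
        grind
      rw [sq_abs] at h1 h2
      rw [Set.indicator_of_mem hq, hfq, add_div]
      have h5 : δ < |q.1.2 - q.2.2| := hq
      have h6 := hb q.1.1 q.2.1
      simp only [hr]
      linarith
    · rw [Set.indicator_of_notMem hq]
      have := hf0 q
      have := hr0 q.1
      have := hr0 q.2
      positivity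
  have hr1 : Integrable (fun q : (Z × ℝ) × (Z × ℝ) => r q.1) (μ.prod μ) := hmse.comp_fst μ
  have hr2 : Integrable (fun q : (Z × ℝ) × (Z × ℝ) => r q.2) (μ.prod μ) := hmse.comp_snd μ
  have hR : Integrable (fun q : (Z × ℝ) × (Z × ℝ) => (r q.1 + r q.2) / (2 * t)) (μ.prod μ) :=
    (hr1.add hr2).div_const _
  have hA : Integrable (fun q : (Z × ℝ) × (Z × ℝ) => t + (r q.1 + r q.2) / (2 * t)) (μ.prod μ) :=
    (integrable_const t).add hR
  have hB : Integrable (fun q => L * (√ε / 2 + f q / (2 * √ε))) (μ.prod μ) :=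
    ((integrable_const _).add (hicl.div_const _)).const_mul L
  have hmono := integral_mono ((integrable_const δ).indicator hDm) (hA.add hB) hpt
  have hmean1 : ∫ q, r q.1 ∂(μ.prod μ) = ∫ p, r p ∂μ := by
    simpa using integral_fun_fst (μ := μ) (ν := μ) r
  have hmean2 : ∫ q, r q.2 ∂(μ.prod μ) = ∫ p, r p ∂μ := by
    simpa using integral_fun_snd (μ := μ) (ν := μ) r
  have hleft : ∫ q, D.indicator (fun _ => δ) q ∂(μ.prod μ) = δ * ρ := by
    rw [integral_indicator_const _ hDm, hρ, smul_eq_mul, mul_comm, Measure.real]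
  have hright : ∫ q, (t + (r q.1 + r q.2) / (2 * t) + L * (√ε / 2 + f q / (2 * √ε))) ∂(μ.prod μ)
      = t + (∫ p, r p ∂μ) / t + L * (√ε / 2 + (∫ q, f q ∂(μ.prod μ)) / (2 * √ε)) := by
    rw [integral_add hA hB, integral_add (integrable_const t) hR,
      integral_div, integral_add hr1 hr2, integral_const_mul,
      integral_add (integrable_const _) (hicl.div_const _), integral_div _ f, hmean1, hmean2]
    simp only [integral_const, probReal_univ, one_smul]
    field_simp
    ring
  have hbound : δ * ρ ≤ t + (∫ p, r p ∂μ) / t +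
      L * (√ε / 2 + (∫ q, f q ∂(μ.prod μ)) / (2 * √ε)) := by
    rw [← hleft, ← hright]
    exact hmono
  have hICL : √ε / 2 + (∫ q, f q ∂(μ.prod μ)) / (2 * √ε) ≤ √ε := by
    have : (∫ q, f q ∂(μ.prod μ)) / (2 * √ε) ≤ √ε / 2 := by
      rw [div_le_iff₀ (by positivity)]
      nlinarith [Real.mul_self_sqrt hε0.le]
    linarith
  have hfinal : t ≤ (∫ p, r p ∂μ) / t := by
    have := mul_le_mul_of_nonneg_left hICL hL.le
    linarith
  rw [le_div_iff₀ ht] at hfinal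
  calc (δ * ρ - L * √ε) ^ 2 / 4 = t * t := by rw [ht_def]; ring
    _ ≤ ∫ p, r p ∂μ := hfinal
end

section
/- Let (Z, d) be a metric space, let (z,c) be a Z × ℝ valued random pair with joint law μ, let α ∈ ℝ, β > 0, δ ≥ 0, ε > 0, and let b : Z → ℝ be L-Lipschitz with respect to d (L > 0). If ICL^δ_{α,β}(z,c) < ε, then for iid pairs (z,c),(z',c') ~ μ one has E[ 1(|c − c'| > δ)·|b(z') − b(z)| ] < L·√ε. -/
open MeasureTheory
open scoped ENNReal

/-- If `b : Z → ℝ` is `L`-Lipschitz and `ICL^δ_{α,β}(z,c) < ε`, then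
`E[1(|c − c'| > δ)·|b(z') − b(z)|] < L·√ε` for iid pairs `(z,c), (z',c')`. -/
theorem icl_small_implies_adversary_increment_bound
    {Z : Type*} [MetricSpace Z] [MeasurableSpace Z] [BorelSpace Z]
    (α β δ ε : ℝ) (hβ : 0 < β) (hδ : 0 ≤ δ) (hε : 0 < ε)
    (μ : Measure (Z × ℝ)) [IsProbabilityMeasure μ]
    (b : Z → ℝ) (L : ℝ) (hL : 0 < L)
    (hb : ∀ z z' : Z, |b z - b z'| ≤ L * dist z z')
    (hicl : Integrable (fun q : (Z × ℝ) × (Z × ℝ) =>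
        if |q.1.2 - q.2.2| ≤ δ then Real.exp (α - β * dist q.1.1 q.2.1)
        else dist q.1.1 q.2.1 ^ 2) (μ.prod μ))
    (hIC : (∫ q, (if |q.1.2 - q.2.2| ≤ δ then Real.exp (α - β * dist q.1.1 q.2.1)
        else dist q.1.1 q.2.1 ^ 2) ∂(μ.prod μ)) < ε) :
    (∫ q, (if δ < |q.1.2 - q.2.2| then |b q.2.1 - b q.1.1| else 0) ∂(μ.prod μ))
      < L * Real.sqrt ε := by
  set s := Real.sqrt ε with hs
  have hs0 : 0 < s := Real.sqrt_pos.mpr hε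
  have hss : s ^ 2 = ε := Real.sq_sqrt hε.le
  have hk : 0 < L / (2 * s) := by positivity
  have hbound := integral_mono_of_nonneg (μ := μ.prod μ)
    (f := fun q : (Z × ℝ) × (Z × ℝ) =>
      if δ < |q.1.2 - q.2.2| then |b q.2.1 - b q.1.1| else 0)
    (Filter.Eventually.of_forall fun q => by
      dsimp only [Pi.zero_apply]
      split_ifs <;> positivity)
    ((hicl.add (integrable_const ε)).const_mul (L / (2 * s)))
    (Filter.Eventually.of_forall fun q => by
      dsimp only [Pi.add_apply]
      by_cases h : |q.1.2 - q.2.2| ≤ δ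
      · rw [if_neg (not_lt.mpr h), if_pos h]
        positivity
      · rw [if_pos (not_le.mp h), if_neg h]
        have hamgm : 2 * s * dist q.1.1 q.2.1 ≤ dist q.1.1 q.2.1 ^ 2 + ε := by
          nlinarith [sq_nonneg (dist q.1.1 q.2.1 - s)]
        calc |b q.2.1 - b q.1.1| ≤ L * dist q.1.1 q.2.1 := by
              simpa only [dist_comm] using hb q.2.1 q.1.1
          _ = L / (2 * s) * (2 * s * dist q.1.1 q.2.1) := by field_simp
          _ ≤ _ := mul_le_mul_of_nonneg_left hamgm hk.le)
  rw [integral_const_mul, integral_add' hicl (integrable_const ε), integral_const,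
    probReal_univ, one_smul] at hbound
  calc _ ≤ _ := hbound
    _ < L / (2 * s) * (ε + ε) := by gcongr
    _ = L * s := by
      rw [← hss]
      field_simp
      ring
end

section
/- Let (Z, d) be a metric space, let (z,c) be a Z × ℝ valued random pair, and let (z',c') be an independent copy of (z,c). Let b : Z → ℝ be measurable with E[(b(z) − c)²] < ∞, and let δ > 0. Then 4·E[(b(z) − c)²] ≥ ( E[ 1(|c − c'| > δ)·|c' − c| ] − E[ 1(|c − c'| > δ)·|b(z') − b(z)| ] )², provided both expectations on the right-hand side are finite. -/
open MeasureTheory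
open scoped ENNReal

/-- Jensen's inequality for the square, with an integrable majorant of the square. -/
theorem sq_integral_le_integral_of_sq_le {Ω : Type*} [MeasurableSpace Ω] {P : Measure Ω}
    [IsProbabilityMeasure P] {g k : Ω → ℝ} (hg : Integrable g P) (hk : Integrable k P)
    (hgk : ∀ x, g x ^ 2 ≤ k x) : (∫ x, g x ∂P) ^ 2 ≤ ∫ x, k x ∂P := by
  set m := ∫ x, g x ∂P with hm
  have h : ∫ x, (2 * m * g x - m ^ 2) ∂P ≤ ∫ x, k x ∂P :=
    integral_mono ((hg.const_mul _).sub (integrable_const _)) hk fun x => by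
      dsimp only
      nlinarith [sq_nonneg (g x - m), hgk x]
  rw [integral_sub (hg.const_mul _) (integrable_const _), integral_const_mul, ← hm] at h
  simp only [integral_const, probReal_univ, one_smul] at h
  linarith

theorem sq_abs_sub_abs_le (x y x' y' : ℝ) :
    (|y' - y| - |x' - x|) ^ 2 ≤ 2 * (x - y) ^ 2 + 2 * (x' - y') ^ 2 := by
  have h : (|y' - y| - |x' - x|) ^ 2 ≤ ((y' - y) - (x' - x)) ^ 2 :=
    sq_le_sq.mpr (abs_abs_sub_abs_le _ _)
  nlinarith [sq_nonneg ((x - y) + (x' - y'))]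

/-- Central MSE lower-bound step: for an iid pair `(z,c), (z',c')` with law `μ` and a
measurable adversary `b` with finite mean squared error,
`4·E[(b(z) − c)²] ≥ (E[1(|c−c'|>δ)·|c'−c|] − E[1(|c−c'|>δ)·|b(z')−b(z)|])²`,
provided both expectations on the right-hand side are finite. -/
theorem mse_lower_bound_central_step
    {Z : Type*} [MetricSpace Z] [MeasurableSpace Z] [BorelSpace Z]
    (μ : Measure (Z × ℝ)) [IsProbabilityMeasure μ]
    (b : Z → ℝ) (hb : Measurable b) (δ : ℝ) (hδ : 0 < δ)
    (hmse : Integrable (fun p : Z × ℝ => (b p.1 - p.2) ^ 2) μ)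
    (h1 : Integrable (fun q : (Z × ℝ) × (Z × ℝ) =>
        if δ < |q.1.2 - q.2.2| then |q.2.2 - q.1.2| else 0) (μ.prod μ))
    (h2 : Integrable (fun q : (Z × ℝ) × (Z × ℝ) =>
        if δ < |q.1.2 - q.2.2| then |b q.2.1 - b q.1.1| else 0) (μ.prod μ)) :
    ((∫ q, (if δ < |q.1.2 - q.2.2| then |q.2.2 - q.1.2| else 0) ∂(μ.prod μ))
      - ∫ q, (if δ < |q.1.2 - q.2.2| then |b q.2.1 - b q.1.1| else 0) ∂(μ.prod μ)) ^ 2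
    ≤ 4 * ∫ p, (b p.1 - p.2) ^ 2 ∂μ := by
  have hfst := hmse.comp_fst μ
  have hsnd := hmse.comp_snd μ
  have hk := (hfst.const_mul 2).add (hsnd.const_mul 2)
  rw [← integral_sub h1 h2]
  refine (sq_integral_le_integral_of_sq_le (h1.sub h2) hk fun q => ?_).trans_eq ?_
  · simp only [Pi.add_apply, Pi.sub_apply]
    split_ifs
    · exact sq_abs_sub_abs_le _ _ _ _
    · rw [sub_zero, zero_pow two_ne_zero]
      positivity
  · rw [integral_add' (hfst.const_mul 2) (hsnd.const_mul 2), integral_const_mul,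
      integral_const_mul, integral_fun_fst (fun p : Z × ℝ => (b p.1 - p.2) ^ 2),
      integral_fun_snd (fun p : Z × ℝ => (b p.1 - p.2) ^ 2)]
    simp only [probReal_univ, one_smul]
    ring
end

section
/- Fix α ∈ ℝ and β > 0, and on ℝ^d define f(x,y) = exp(α − β·‖x − y‖₂), s(x,y) = ‖x − y‖₂², and g(x,y) = (f(x,y) − s(x,y))/8. Then g is conditionally positive definite: for every n ≥ 1, every x₁, …, x_n ∈ ℝ^d, and every a₁, …, a_n ∈ ℝ with Σᵢ aᵢ = 0, one has Σᵢ Σⱼ aᵢ·aⱼ·g(xᵢ, xⱼ) ≥ 0. -/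
open scoped BigOperators

/-- A symmetric real matrix with zero diagonal that is conditionally negative definite: its
quadratic form is nonpositive on weight vectors summing to zero. -/
structure IsCondNegDef {ι : Type*} [Fintype ι] (N : ι → ι → ℝ) : Prop where
  symm : ∀ i j, N i j = N j i
  diag : ∀ i, N i i = 0
  nonpos : ∀ a : ι → ℝ, ∑ i, a i = 0 → ∑ i, ∑ j, a i * a j * N i j ≤ 0

theorem Matrix.posSemidef_iff_sum_nonneg {ι : Type*} [Fintype ι] {K : Matrix ι ι ℝ}
    (hK : ∀ i j, K i j = K j i) :
    K.PosSemidef ↔ ∀ a : ι → ℝ, 0 ≤ ∑ i, ∑ j, a i * a j * K i j := by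
  have hH : K.IsHermitian := by
    ext i j
    simp [hK i j]
  rw [Matrix.posSemidef_iff_dotProduct_mulVec]
  simp only [hH, true_and, dotProduct, Matrix.mulVec, Finset.mul_sum, star_trivial, mul_assoc,
    mul_comm (K _ _)]

/-- The entrywise exponential of a positive semidefinite matrix is positive semidefinite. -/
theorem Matrix.PosSemidef.sum_mul_exp_nonneg {ι : Type*} [Fintype ι] {K : Matrix ι ι ℝ}
    (hK : K.PosSemidef) (a : ι → ℝ) :
    0 ≤ ∑ i, ∑ j, a i * a j * Real.exp (K i j) := by
  have hsymm : ∀ i j, K i j = K j i := fun i j => by simpa using (hK.isHermitian.apply i j).symm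
  have hpow : ∀ k : ℕ, (Matrix.of fun i j => K i j ^ k).PosSemidef := by
    intro k
    induction k with
    | zero =>
      refine (Matrix.posSemidef_iff_sum_nonneg fun i j => by simp).2 fun b => ?_
      have : ∑ i, ∑ j, b i * b j * (Matrix.of fun i j => K i j ^ 0) i j = (∑ i, b i) ^ 2 := by
        simp [sq, Finset.sum_mul_sum]
      rw [this]
      positivity
    | succ k ih =>
      have h := ih.hadamard hK
      have e : (Matrix.of fun i j => K i j ^ (k + 1))
          = Matrix.hadamard (Matrix.of fun i j => K i j ^ k) K := by
        ext i j
        simp [pow_succ]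
      rw [e]
      exact h
  have hsum : HasSum (fun k : ℕ => ∑ i, ∑ j, a i * a j * (K i j ^ k / k.factorial))
      (∑ i, ∑ j, a i * a j * Real.exp (K i j)) := by
    refine hasSum_sum fun i _ => hasSum_sum fun j _ => HasSum.mul_left _ ?_
    rw [Real.exp_eq_exp_ℝ]
    exact NormedSpace.expSeries_div_hasSum_exp (K i j)
  refine hsum.nonneg fun k => ?_
  have h := (Matrix.posSemidef_iff_sum_nonneg
    (K := Matrix.of fun i j => K i j ^ k) fun i j => by simp [hsymm i j]).1 (hpow k) a
  have := div_nonneg h (Nat.cast_nonneg (α := ℝ) k.factorial)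
  simpa only [Finset.sum_div, mul_div_assoc, Matrix.of_apply] using this

namespace IsCondNegDef

variable {ι : Type*} [Fintype ι] {N : ι → ι → ℝ}

theorem const_mul (hN : IsCondNegDef N) {c : ℝ} (hc : 0 ≤ c) :
    IsCondNegDef fun i j => c * N i j where
  symm i j := by rw [hN.symm]
  diag i := by rw [hN.diag, mul_zero]
  nonpos a ha := by
    have h := mul_nonpos_of_nonneg_of_nonpos hc (hN.nonpos a ha)
    simpa only [Finset.mul_sum, mul_left_comm c] using h

theorem posSemidef (hN : IsCondNegDef N) (o : ι) :
    (Matrix.of fun i j => N i o + N o j - N i j).PosSemidef := by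
  classical
  refine (Matrix.posSemidef_iff_sum_nonneg fun i j => ?_).2 fun c => ?_
  · simp only [Matrix.of_apply]
    rw [hN.symm i o, hN.symm o j, hN.symm i j]
    ring
  · set S := ∑ i, c i with hS
    have h := hN.nonpos (fun i => c i - if i = o then S else 0) (by simp [hS])
    have e : ∑ i, ∑ j, (c i - if i = o then S else 0) * (c j - if j = o then S else 0) * N i j
        = ∑ i, ∑ j, c i * c j * N i j - S * ∑ i, c i * N i o - S * ∑ j, c j * N o j := by
      simp only [sub_mul, mul_sub, Finset.sum_sub_distrib, ite_mul, mul_ite, zero_mul, mul_zero,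
        Finset.sum_ite_eq', Finset.mem_univ, if_true, hN.diag, Finset.mul_sum,
        Finset.sum_ite_irrel, Finset.sum_const_zero]
      simp only [mul_comm, mul_left_comm, sub_zero]
      ring
    have e' : ∑ i, ∑ j, c i * c j * (N i o + N o j - N i j)
        = S * ∑ i, c i * N i o + S * ∑ j, c j * N o j - ∑ i, ∑ j, c i * c j * N i j := by
      simp only [mul_sub, mul_add, Finset.sum_sub_distrib, Finset.sum_add_distrib]
      congr 2
      · rw [hS, Finset.sum_mul_sum, Finset.sum_comm]
        simp only [mul_comm, mul_left_comm]
      · rw [hS, Finset.sum_mul_sum]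
        simp only [mul_assoc]
    simp only [Matrix.of_apply]
    rw [e']
    rw [e] at h
    linarith

/-- **Schoenberg's theorem**: if `N` is conditionally negative definite, then `exp (-N)` is
positive semidefinite. -/
theorem sum_mul_exp_neg_nonneg (hN : IsCondNegDef N) (a : ι → ℝ) :
    0 ≤ ∑ i, ∑ j, a i * a j * Real.exp (-N i j) := by
  rcases isEmpty_or_nonempty ι with h | ⟨⟨o⟩⟩
  · simp
  · convert (hN.posSemidef o).sum_mul_exp_nonneg fun i => a i * Real.exp (-N i o)
      using 2 with i _
    refine Finset.sum_congr rfl fun j _ => ?_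
    rw [Matrix.of_apply, hN.symm o j, mul_mul_mul_comm, mul_assoc (a i * a j), ← Real.exp_add,
      ← Real.exp_add]
    ring_nf

end IsCondNegDef

section Norm

variable {ι E : Type*} [Fintype ι] [NormedAddCommGroup E] [InnerProductSpace ℝ E]

theorem sum_mul_norm_sub_sq (x : ι → E) (a : ι → ℝ) (ha : ∑ i, a i = 0) :
    ∑ i, ∑ j, a i * a j * ‖x i - x j‖ ^ 2 = -2 * ‖∑ i, a i • x i‖ ^ 2 := by
  have h1 : ∑ i, ∑ j, a i * a j * ‖x i‖ ^ 2 = 0 := by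
    simp only [← Finset.sum_mul, ← Finset.mul_sum, ha, mul_zero, zero_mul, Finset.sum_const_zero]
  have h2 : ∑ i, ∑ j, a i * a j * ‖x j‖ ^ 2 = 0 := by
    simp only [mul_assoc, ← Finset.mul_sum]
    rw [← Finset.sum_mul, ha, zero_mul]
  have h3 : ‖∑ i, a i • x i‖ ^ 2 = ∑ i, ∑ j, a i * a j * inner ℝ (x i) (x j) := by
    rw [← real_inner_self_eq_norm_sq, sum_inner]
    simp only [inner_sum, real_inner_smul_left, real_inner_smul_right, mul_assoc,
      mul_left_comm]
  have h4 : ∀ i j, a i * a j * ‖x i - x j‖ ^ 2 = a i * a j * ‖x i‖ ^ 2 + a i * a j * ‖x j‖ ^ 2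
      + -2 * (a i * a j * inner ℝ (x i) (x j)) := by
    intro i j
    rw [norm_sub_sq_real]
    ring
  simp only [h4, Finset.sum_add_distrib, h1, h2, h3, ← Finset.mul_sum, zero_add]

theorem isCondNegDef_norm_sub_sq (x : ι → E) :
    IsCondNegDef fun i j => ‖x i - x j‖ ^ 2 where
  symm i j := by rw [norm_sub_rev]
  diag i := by simp
  nonpos a ha := by
    rw [sum_mul_norm_sub_sq x a ha]
    nlinarith [sq_nonneg ‖∑ i, a i • x i‖]

end Norm

section SqrtIntegral

open MeasureTheory

theorem one_sub_exp_neg_sq_div_sq_nonneg (w : ℝ) : 0 ≤ (1 - Real.exp (-w ^ 2)) / w ^ 2 := by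
  have : Real.exp (-w ^ 2) ≤ 1 := Real.exp_le_one_iff.2 (by nlinarith [sq_nonneg w])
  exact div_nonneg (by linarith) (sq_nonneg w)

theorem integrable_one_sub_exp_neg_sq_div_sq :
    Integrable fun w : ℝ => (1 - Real.exp (-w ^ 2)) / w ^ 2 := by
  refine (integrable_inv_one_add_sq.const_mul 2).mono'
    (Measurable.aestronglyMeasurable (by fun_prop)) (.of_forall fun w => ?_)
  rw [Real.norm_of_nonneg (one_sub_exp_neg_sq_div_sq_nonneg w)]
  rcases eq_or_ne w 0 with rfl | hw
  · simp
  have hw2 : 0 < w ^ 2 := by positivity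
  have h1 := Real.add_one_le_exp (-w ^ 2)
  have h2 := Real.exp_pos (-w ^ 2)
  rw [← div_eq_mul_inv, div_le_div_iff₀ hw2 (by positivity)]
  nlinarith

theorem integral_one_sub_exp_neg_sq_div_sq_pos :
    0 < ∫ w : ℝ, (1 - Real.exp (-w ^ 2)) / w ^ 2 := by
  rw [integral_pos_iff_support_of_nonneg one_sub_exp_neg_sq_div_sq_nonneg
    integrable_one_sub_exp_neg_sq_div_sq]
  refine lt_of_lt_of_le ?_ (measure_mono (s := Set.Ioi (0 : ℝ)) fun w hw => ?_)
  · simp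
  · have hw2 : 0 < w ^ 2 := pow_pos hw 2
    have : Real.exp (-w ^ 2) < 1 := Real.exp_lt_one_iff.2 (by linarith)
    exact (div_pos (by linarith) hw2).ne'

theorem one_sub_exp_neg_mul_sq_div_sq (r w : ℝ) :
    (1 - Real.exp (-(w ^ 2 * r ^ 2))) / w ^ 2
      = r ^ 2 * ((1 - Real.exp (-(r * w) ^ 2)) / (r * w) ^ 2) := by
  rcases eq_or_ne r 0 with rfl | hr
  · simp
  · rw [mul_pow, mul_comm (w ^ 2), ← mul_div_assoc, mul_div_mul_left _ _ (pow_ne_zero 2 hr)]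

theorem integrable_one_sub_exp_neg_mul_sq_div_sq (r : ℝ) :
    Integrable fun w : ℝ => (1 - Real.exp (-(w ^ 2 * r ^ 2))) / w ^ 2 := by
  rcases eq_or_ne r 0 with rfl | hr
  · simp
  · simp only [one_sub_exp_neg_mul_sq_div_sq r]
    exact (integrable_one_sub_exp_neg_sq_div_sq.comp_mul_left' hr).const_mul _

theorem integral_one_sub_exp_neg_mul_sq_div_sq {r : ℝ} (hr : 0 ≤ r) :
    ∫ w : ℝ, (1 - Real.exp (-(w ^ 2 * r ^ 2))) / w ^ 2
      = r * ∫ w : ℝ, (1 - Real.exp (-w ^ 2)) / w ^ 2 := by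
  simp only [one_sub_exp_neg_mul_sq_div_sq r]
  rw [integral_const_mul,
    Measure.integral_comp_mul_left (fun w : ℝ => (1 - Real.exp (-w ^ 2)) / w ^ 2) r,
    abs_of_nonneg (inv_nonneg.2 hr), smul_eq_mul, ← mul_assoc]
  congr 1
  rcases eq_or_ne r 0 with rfl | hr
  · simp
  · field_simp

/-- The square root of a conditionally negative definite matrix is conditionally negative
definite, as `r` is proportional to the integral of `(1 - exp (-w² r²)) / w²` over `w`. -/
theorem IsCondNegDef.of_sq {ι : Type*} [Fintype ι] {R : ι → ι → ℝ} (hR : ∀ i j, 0 ≤ R i j)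
    (h : IsCondNegDef fun i j => R i j ^ 2) : IsCondNegDef R where
  symm i j := (pow_left_inj₀ (hR i j) (hR j i) two_ne_zero).1 (h.symm i j)
  diag i := pow_eq_zero_iff two_ne_zero |>.1 (h.diag i)
  nonpos a ha := by
    refine nonpos_of_mul_nonpos_left ?_ integral_one_sub_exp_neg_sq_div_sq_pos
    have hint : ∀ i j, Integrable fun w : ℝ =>
        a i * a j * ((1 - Real.exp (-(w ^ 2 * R i j ^ 2))) / w ^ 2) := fun i j =>
      (integrable_one_sub_exp_neg_mul_sq_div_sq (R i j)).const_mul _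
    have e : (∑ i, ∑ j, a i * a j * R i j) * ∫ w : ℝ, (1 - Real.exp (-w ^ 2)) / w ^ 2
        = ∫ w : ℝ, ∑ i, ∑ j, a i * a j * ((1 - Real.exp (-(w ^ 2 * R i j ^ 2))) / w ^ 2) := by
      rw [integral_finsetSum _ fun i _ => integrable_finsetSum _ fun j _ => hint i j]
      simp only [Finset.sum_mul]
      refine Finset.sum_congr rfl fun i _ => ?_
      rw [integral_finsetSum _ fun j _ => hint i j]
      refine Finset.sum_congr rfl fun j _ => ?_
      rw [integral_const_mul, integral_one_sub_exp_neg_mul_sq_div_sq (hR i j), mul_assoc]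
    rw [e]
    refine integral_nonpos fun w => ?_
    have hexp := (h.const_mul (sq_nonneg w)).sum_mul_exp_neg_nonneg a
    have e' : ∑ i, ∑ j, a i * a j * ((1 - Real.exp (-(w ^ 2 * R i j ^ 2))) / w ^ 2)
        = -((∑ i, ∑ j, a i * a j * Real.exp (-(w ^ 2 * R i j ^ 2))) / w ^ 2) := by
      simp only [← mul_div_assoc, ← Finset.sum_div, mul_sub, mul_one, Finset.sum_sub_distrib]
      simp only [← Finset.mul_sum, ha, mul_zero, Finset.sum_const_zero, zero_sub, neg_div]
    simp only [Pi.zero_apply]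
    rw [e']
    exact neg_nonpos.2 (div_nonneg hexp (sq_nonneg w))

end SqrtIntegral

/-- The kernel `g(x,y) = (exp(α − β·‖x − y‖₂) − ‖x − y‖₂²)/8` on `ℝ^d` is conditionally
positive definite: for points `x₁,…,xₙ` and real weights `a₁,…,aₙ` summing to zero,
`Σᵢ Σⱼ aᵢ·aⱼ·g(xᵢ,xⱼ) ≥ 0`. -/
theorem g_kernel_conditionally_positive_definite
    (d : ℕ) (α β : ℝ) (hβ : 0 < β) (n : ℕ) (hn : 1 ≤ n)
    (x : Fin n → EuclideanSpace ℝ (Fin d)) (a : Fin n → ℝ)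
    (ha : ∑ i, a i = 0) :
    0 ≤ ∑ i, ∑ j, a i * a j *
        ((Real.exp (α - β * ‖x i - x j‖) - ‖x i - x j‖ ^ 2) / 8) := by
  have hsq := isCondNegDef_norm_sub_sq x
  have hexp := ((hsq.of_sq fun i j => norm_nonneg _).const_mul hβ.le).sum_mul_exp_neg_nonneg a
  have e : ∑ i, ∑ j, a i * a j * ((Real.exp (α - β * ‖x i - x j‖) - ‖x i - x j‖ ^ 2) / 8)
      = (Real.exp α * ∑ i, ∑ j, a i * a j * Real.exp (-(β * ‖x i - x j‖))
        - ∑ i, ∑ j, a i * a j * ‖x i - x j‖ ^ 2) / 8 := by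
    simp only [Finset.mul_sum, ← Finset.sum_sub_distrib, Finset.sum_div]
    refine Finset.sum_congr rfl fun i _ => Finset.sum_congr rfl fun j _ => ?_
    rw [sub_eq_add_neg α, Real.exp_add]
    ring
  rw [e]
  have := mul_nonneg (Real.exp_pos α).le hexp
  linarith [hsq.nonpos a ha]
end
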